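/- Let Q_ℓ = {1,…,ℓ}^d with nearest-neighbor edges and graph Laplacian L, let (α_x)_{x∈Q_ℓ} be i.i.d. standard real Gaussians, set α̂_x = α_x − ℓ^{-d} Σ_z α_z, and let g be the unique mean-zero solution of Lg = α̂. Then there are constants 0 < c ≤ C such that for all ℓ ≥ 2 the per-site variance of the field g satisfies: if d = 2, c ℓ² ≤ ℓ^{-2} E[Σ_{x} g_x²] ≤ C ℓ²; if d = 3, c ℓ ≤ ℓ^{-3} E[Σ_{x} g_x²] ≤ C ℓ; and if d = 4, c log ℓ ≤ ℓ^{-4} E[Σ_{x} g_x²] ≤ C log ℓ. (This makes precise the claim that g_{Q_ℓ,x} has typical order of magnitude ℓ, √ℓ and √(log ℓ) in dimensions 2, 3 and 4 respectively, which forces the constraint ℓ ≲ ε^{-1} in two dimensions.) -/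

import Mathlib

open scoped Classical BigOperators
open MeasureTheory

noncomputable section

/-- A site of the lattice `ℤ^d`. -/
abbrev Site (d : ℕ) := Fin d → ℤ

/-- The ℓ¹ distance on `ℤ^d`; nearest neighbors are at ℓ¹ distance 1. -/
def l1dist {d : ℕ} (x y : Site d) : ℤ := ∑ i, |x i - y i|

/-- The box `Q_ℓ = {1,…,ℓ}^d` as a Finset of `ℤ^d`. -/
def boxQ (d : ℕ) (ℓ : ℕ) : Finset (Site d) := Fintype.piFinset fun _ => Finset.Icc 1 (ℓ : ℤ)

/-- The graph Laplacian of the box `Q_ℓ` with nearest-neighbor edges: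
`(Lθ)_x = Σ_{y∼x} (θ_x − θ_y)`, i.e. degree on the diagonal and `−1` between neighbors. -/
def boxLap (d : ℕ) (ℓ : ℕ) : Matrix (boxQ d ℓ) (boxQ d ℓ) ℝ := fun x y =>
  if (x : Site d) = (y : Site d) then
    (((boxQ d ℓ).filter fun z => l1dist z (x : Site d) = 1).card : ℝ)
  else if l1dist (x : Site d) (y : Site d) = 1 then -1 else 0

/-- The centered disorder `α̂_x = α_x − ℓ^{-d} Σ_z α_z`. -/
def centered (d ℓ : ℕ) (α : boxQ d ℓ → ℝ) : boxQ d ℓ → ℝ :=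
  fun x => α x - (∑ z, α z) / (ℓ : ℝ) ^ d

/-- The i.i.d. standard Gaussian disorder distribution on `ℝ^{Q_ℓ}`. -/
def disorderP (d ℓ : ℕ) : Measure (boxQ d ℓ → ℝ) :=
  Measure.pi fun _ => ProbabilityTheory.gaussianReal 0 1

/-- The Neumann cosine eigenfunctions of the path `{1,…,ℓ}`, extended to `ℤ`. -/
def cosMode (ℓ k : ℕ) (t : ℤ) : ℝ := Real.cos (Real.pi * k * (t - 1 / 2) / ℓ)

/-- The Laplacian eigenvalue of `cosMode ℓ k`. -/
def cosEig (ℓ k : ℕ) : ℝ := 2 - 2 * Real.cos (Real.pi * k / ℓ)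

lemma cosMode_recurrence (ℓ k : ℕ) (t : ℤ) :
    cosMode ℓ k (t + 1) + cosMode ℓ k (t - 1) = (2 - cosEig ℓ k) * cosMode ℓ k t := by
  have h1 : Real.pi * k * (((t + 1 : ℤ) : ℝ) - 1 / 2) / ℓ
      = Real.pi * k * (t - 1 / 2) / ℓ + Real.pi * k / ℓ := by push_cast; ring
  have h2 : Real.pi * k * (((t - 1 : ℤ) : ℝ) - 1 / 2) / ℓ
      = Real.pi * k * (t - 1 / 2) / ℓ - Real.pi * k / ℓ := by push_cast; ring
  simp only [cosMode, cosEig]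
  rw [h1, h2, Real.cos_add, Real.cos_sub]
  ring

lemma cosMode_zero_eq_one (ℓ k : ℕ) : cosMode ℓ k 0 = cosMode ℓ k 1 := by
  unfold cosMode
  rw [← Real.cos_neg]
  congr 1
  push_cast; ring

lemma cosMode_succ_eq (ℓ k : ℕ) (hℓ : 0 < ℓ) : cosMode ℓ k (ℓ + 1) = cosMode ℓ k ℓ := by
  have h : (ℓ : ℝ) ≠ 0 := by positivity
  have h1 : Real.pi * k * (((ℓ + 1 : ℤ) : ℝ) - 1 / 2) / ℓ
      = k * Real.pi + Real.pi * k / (2 * ℓ) := by push_cast; field_simp; ring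
  have h2 : Real.pi * k * (((ℓ : ℤ) : ℝ) - 1 / 2) / ℓ
      = k * Real.pi - Real.pi * k / (2 * ℓ) := by push_cast; field_simp
  unfold cosMode
  rw [h1, h2, Real.cos_add, Real.cos_sub, Real.sin_nat_mul_pi]
  ring

lemma cosMode_one_pos {ℓ k : ℕ} (hk : k < ℓ) : 0 < cosMode ℓ k 1 := by
  have hℓ : (0 : ℝ) < ℓ := by exact_mod_cast (Nat.zero_le k).trans_lt hk
  have hk' : (k : ℝ) < ℓ := by exact_mod_cast hk
  have hpi := Real.pi_pos
  have h0 : (0 : ℝ) ≤ k := by positivity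
  apply Real.cos_pos_of_mem_Ioo
  constructor
  · have : 0 ≤ Real.pi * k * (((1 : ℤ) : ℝ) - 1 / 2) / ℓ := by norm_num; positivity
    linarith
  · rw [div_lt_iff₀ hℓ]
    push_cast
    nlinarith

lemma sum_Icc_telescope (W : ℤ → ℝ) (n : ℕ) :
    ∑ t ∈ Finset.Icc (1 : ℤ) n, (W t - W (t - 1)) = W n - W 0 := by
  induction n with
  | zero => simp
  | succ n ih =>
    have : Finset.Icc (1 : ℤ) ((n + 1 : ℕ) : ℤ)
        = insert ((n : ℤ) + 1) (Finset.Icc (1 : ℤ) n) := by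
      ext t; simp only [Finset.mem_Icc, Finset.mem_insert]; omega
    rw [this, Finset.sum_insert (by simp), ih]
    push_cast; simp

lemma cosEig_injOn {ℓ k k' : ℕ} (hk : k < ℓ) (hk' : k' < ℓ) (h : cosEig ℓ k = cosEig ℓ k') :
    k = k' := by
  have hℓ : (0 : ℝ) < ℓ := by exact_mod_cast (Nat.zero_le k).trans_lt hk
  have mem : ∀ {j : ℕ}, j < ℓ → Real.pi * j / ℓ ∈ Set.Icc 0 Real.pi := fun {j} hj => by
    have : (j : ℝ) ≤ ℓ := by exact_mod_cast hj.le
    refine ⟨by positivity, ?_⟩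
    rw [div_le_iff₀ hℓ]
    exact mul_le_mul_of_nonneg_left this Real.pi_pos.le
  have := Real.injOn_cos (mem hk) (mem hk') (by unfold cosEig at h; linarith)
  field_simp at this
  exact_mod_cast this

lemma cosMode_orthogonal {ℓ k k' : ℕ} (hk : k < ℓ) (hk' : k' < ℓ) (hne : k ≠ k') :
    ∑ t ∈ Finset.Icc (1 : ℤ) ℓ, cosMode ℓ k t * cosMode ℓ k' t = 0 := by
  have hℓ : 0 < ℓ := (Nat.zero_le k).trans_lt hk
  have h := sum_Icc_telescope (fun t => cosMode ℓ k (t + 1) * cosMode ℓ k' t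
    - cosMode ℓ k t * cosMode ℓ k' (t + 1)) ℓ
  have h2 : ∀ t : ℤ, (cosMode ℓ k (t + 1) * cosMode ℓ k' t
      - cosMode ℓ k t * cosMode ℓ k' (t + 1))
      - (cosMode ℓ k (t - 1 + 1) * cosMode ℓ k' (t - 1)
      - cosMode ℓ k (t - 1) * cosMode ℓ k' (t - 1 + 1))
      = (cosEig ℓ k' - cosEig ℓ k) * (cosMode ℓ k t * cosMode ℓ k' t) := fun t => by
    rw [sub_add_cancel]
    linear_combination cosMode ℓ k' t * cosMode_recurrence ℓ k t
      - cosMode ℓ k t * cosMode_recurrence ℓ k' t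
  simp only [h2, ← Finset.mul_sum, cosMode_succ_eq _ _ hℓ, zero_add, cosMode_zero_eq_one] at h
  have h3 : cosEig ℓ k' - cosEig ℓ k ≠ 0 := fun h0 =>
    hne (cosEig_injOn hk hk' (by linarith))
  exact (mul_eq_zero.mp (h.trans (by ring))).resolve_left h3

/-- The product eigenfunctions of the Laplacian of the box. -/
def boxMode {d ℓ : ℕ} (k : Fin d → Fin ℓ) (x : Site d) : ℝ := ∏ i, cosMode ℓ (k i) (x i)

/-- The Laplacian eigenvalue of `boxMode k`. -/
def boxEig {d ℓ : ℕ} (k : Fin d → Fin ℓ) : ℝ := ∑ i, cosEig ℓ (k i)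

lemma sum_boxQ_prod {d ℓ : ℕ} (f : Fin d → ℤ → ℝ) :
    ∑ x : boxQ d ℓ, ∏ i, f i ((x : Site d) i) = ∏ i, ∑ t ∈ Finset.Icc (1 : ℤ) ℓ, f i t := by
  rw [Finset.prod_univ_sum, Finset.sum_coe_sort (boxQ d ℓ) (fun x => ∏ i, f i (x i)), boxQ]

lemma boxMode_orthogonal {d ℓ : ℕ} {k k' : Fin d → Fin ℓ} (h : k ≠ k') :
    ∑ x : boxQ d ℓ, boxMode k x * boxMode k' x = 0 := by
  obtain ⟨i, hi⟩ := Function.ne_iff.mp h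
  simp only [boxMode, ← Finset.prod_mul_distrib]
  rw [sum_boxQ_prod (fun i t => cosMode ℓ (k i) t * cosMode ℓ (k' i) t)]
  exact Finset.prod_eq_zero (Finset.mem_univ i)
    (cosMode_orthogonal (k i).2 (k' i).2 (fun h => hi (Fin.ext h)))

lemma boxMode_normSq_pos {d ℓ : ℕ} (k : Fin d → Fin ℓ) :
    0 < ∑ x : boxQ d ℓ, boxMode k x ^ 2 := by
  simp only [boxMode, ← Finset.prod_pow]
  rw [sum_boxQ_prod (fun i t => cosMode ℓ (k i) t ^ 2)]
  refine Finset.prod_pos fun i _ => Finset.sum_pos' (fun t _ => sq_nonneg _) ⟨1, ?_, ?_⟩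
  · have := (k i).2
    simp only [Finset.mem_Icc]; omega
  · have := cosMode_one_pos (k i).2
    positivity

lemma l1dist_comm {d : ℕ} (x y : Site d) : l1dist x y = l1dist y x := by
  simp only [l1dist, abs_sub_comm]

lemma l1dist_eq_one_iff {d : ℕ} (x y : Site d) :
    l1dist y x = 1 ↔ ∃ i, ∃ u : ℤˣ, Function.update x i (x i + u) = y := by
  constructor
  · intro h
    have hex : ∃ i, y i ≠ x i := by
      by_contra! hc
      simp [l1dist, hc] at h
    obtain ⟨i, hi⟩ := hex
    have hsplit := Finset.add_sum_erase Finset.univ (fun j => |y j - x j|) (Finset.mem_univ i)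
    have h1 : 1 ≤ |y i - x i| := Int.one_le_abs (sub_ne_zero.mpr hi)
    have hnn : ∀ j ∈ Finset.univ.erase i, 0 ≤ |y j - x j| := fun j _ => abs_nonneg _
    have h2 := Finset.sum_nonneg hnn
    unfold l1dist at h
    have h3 : |y i - x i| = 1 := by omega
    have h4 : ∑ j ∈ Finset.univ.erase i, |y j - x j| = 0 := by omega
    rw [Finset.sum_eq_zero_iff_of_nonneg hnn] at h4
    refine ⟨i, (Int.isUnit_iff_abs_eq.mpr h3).unit, ?_⟩
    ext j
    by_cases hj : j = i
    · subst hj; simp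
    · have := h4 j (by simp [hj])
      rw [Function.update_of_ne hj]
      have := abs_eq_zero.mp this
      omega
  · rintro ⟨i, u, rfl⟩
    unfold l1dist
    rw [Finset.sum_eq_single i]
    · simp [Int.isUnit_iff_abs_eq.mp u.isUnit]
    · intro j _ hj; simp [hj]
    · simp

lemma update_add_unit_injective {d : ℕ} (x : Site d) :
    Function.Injective fun p : Fin d × ℤˣ => Function.update x p.1 (x p.1 + (p.2 : ℤ)) := by
  rintro ⟨i, u⟩ ⟨j, v⟩ h
  have hi := congrFun h i
  by_cases hij : i = j
  · subst hij
    simp at hi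
    rw [Units.ext hi]
  · simp [hij] at hi

lemma sum_neighbors {d ℓ : ℕ} (x : Site d) (f : Site d → ℝ) :
    ∑ z ∈ (boxQ d ℓ).filter (fun z => l1dist z x = 1), f z
      = ∑ i, ∑ u : ℤˣ, if Function.update x i (x i + u) ∈ boxQ d ℓ
        then f (Function.update x i (x i + u)) else 0 := by
  rw [← Fintype.sum_prod_type' (f := fun (i : Fin d) (u : ℤˣ) =>
    if Function.update x i (x i + u) ∈ boxQ d ℓ then f (Function.update x i (x i + u)) else 0),
    ← Finset.sum_filter, ← Finset.sum_image (f := f)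
    (g := fun p : Fin d × ℤˣ => Function.update x p.1 (x p.1 + (p.2 : ℤ)))
    ((update_add_unit_injective x).injOn)]
  congr 1
  ext z
  simp only [Finset.mem_filter, l1dist_eq_one_iff, Finset.mem_image, Finset.mem_univ, true_and,
    Prod.exists]
  constructor
  · rintro ⟨hz, i, u, rfl⟩; exact ⟨i, u, hz, rfl⟩
  · rintro ⟨i, u, hz, rfl⟩; exact ⟨hz, i, u, rfl⟩

lemma boxLap_mulVec {d ℓ : ℕ} (f : Site d → ℝ) (x : boxQ d ℓ) :
    (boxLap d ℓ).mulVec (fun y => f y) x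
      = ∑ z ∈ (boxQ d ℓ).filter (fun z => l1dist z x = 1), (f x - f z) := by
  have hself : ∀ y : Site d, l1dist y y = 0 := fun y => by simp [l1dist]
  have h : ∀ y : boxQ d ℓ, boxLap d ℓ x y * f y
      = (if (y : Site d) = x then
          (((boxQ d ℓ).filter fun z => l1dist z (x : Site d) = 1).card : ℝ) * f y else 0)
        - (if l1dist (y : Site d) x = 1 then f y else 0) := fun y => by
    unfold boxLap
    rw [l1dist_comm (x : Site d) y]
    by_cases hxy : (y : Site d) = x
    · simp [hxy, hself]
    · by_cases h1 : l1dist (y : Site d) x = 1 <;> simp [hxy, Ne.symm hxy, h1]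
  simp only [Matrix.mulVec, dotProduct, h, Finset.sum_sub_distrib]
  rw [Finset.sum_coe_sort (boxQ d ℓ) (fun y => if y = x then
      (((boxQ d ℓ).filter fun z => l1dist z (x : Site d) = 1).card : ℝ) * f y else 0),
    Finset.sum_coe_sort (boxQ d ℓ) (fun y => if l1dist y x = 1 then f y else 0)]
  rw [Finset.sum_ite_eq', if_pos x.2, Finset.sum_filter]
  simp [Finset.sum_ite]

lemma boxMode_update {d ℓ : ℕ} (k : Fin d → Fin ℓ) (x : Site d) (i : Fin d) (t : ℤ) :
    boxMode k (Function.update x i t)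
      = cosMode ℓ (k i) t * ∏ j ∈ Finset.univ.erase i, cosMode ℓ (k j) (x j) := by
  unfold boxMode
  rw [← Finset.mul_prod_erase _ _ (Finset.mem_univ i), Function.update_self]
  congr 1
  exact Finset.prod_congr rfl fun j hj => by rw [Function.update_of_ne (Finset.ne_of_mem_erase hj)]

lemma boxLap_mulVec_boxMode {d ℓ : ℕ} (k : Fin d → Fin ℓ) (x : boxQ d ℓ) :
    (boxLap d ℓ).mulVec (fun y => boxMode k y) x = boxEig k * boxMode k x := by
  have hx : ∀ i, 1 ≤ (x : Site d) i ∧ (x : Site d) i ≤ ℓ := by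
    simpa [boxQ] using x.2
  rw [boxLap_mulVec, sum_neighbors, boxEig, Finset.sum_mul]
  refine Finset.sum_congr rfl fun i _ => ?_
  have hℓ : 0 < ℓ := (Nat.zero_le _).trans_lt (k i).2
  have hdrop : ∀ u : ℤˣ, (if Function.update (x : Site d) i ((x : Site d) i + u) ∈ boxQ d ℓ
      then boxMode k x - boxMode k (Function.update (x : Site d) i ((x : Site d) i + u)) else 0)
      = boxMode k x - boxMode k (Function.update (x : Site d) i ((x : Site d) i + u)) := by
    intro u
    split_ifs with hmem
    · rfl
    · have hself := boxMode_update k x i ((x : Site d) i)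
      rw [Function.update_eq_self] at hself
      rw [boxMode_update, hself]
      have hout : ¬ (1 ≤ (x : Site d) i + u ∧ (x : Site d) i + u ≤ ℓ) := by
        intro hin
        apply hmem
        simp only [boxQ, Fintype.mem_piFinset, Finset.mem_Icc]
        intro j
        by_cases hj : j = i
        · subst hj; simpa using hin
        · simpa [hj] using hx j
      have hxi := hx i
      have : cosMode ℓ (k i) ((x : Site d) i + u) = cosMode ℓ (k i) ((x : Site d) i) := by
        rcases Int.units_eq_one_or u with rfl | rfl
        · have : (x : Site d) i = ℓ := by push_cast at hout; omega
          rw [this]; exact cosMode_succ_eq _ _ hℓ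
        · have : (x : Site d) i = 1 := by push_cast at hout; omega
          rw [this]; exact cosMode_zero_eq_one _ _
      rw [this, sub_self]
  simp only [hdrop]
  have huniv : (Finset.univ : Finset ℤˣ) = {1, -1} := by decide
  rw [huniv, Finset.sum_pair (by decide)]
  have hself := boxMode_update k x i ((x : Site d) i)
  rw [Function.update_eq_self] at hself
  rw [boxMode_update, boxMode_update, hself]
  have := cosMode_recurrence ℓ (k i) ((x : Site d) i)
  push_cast
  rw [← sub_eq_add_neg]
  linear_combination (-∏ j ∈ Finset.univ.erase i, cosMode ℓ (k j) ((x : Site d) j)) * this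

lemma boxLap_isSymm (d ℓ : ℕ) : (boxLap d ℓ).IsSymm := by
  ext x y
  simp only [Matrix.transpose_apply, boxLap]
  rw [l1dist_comm (y : Site d) x]
  by_cases h : (x : Site d) = y
  · simp [h]
  · simp [h, Ne.symm h]

lemma four_mul_sq_div_le_cosEig {ℓ k : ℕ} (hk : k < ℓ) : 4 * (k : ℝ) ^ 2 / ℓ ^ 2 ≤ cosEig ℓ k := by
  have hℓ : (0 : ℝ) < ℓ := by exact_mod_cast (Nat.zero_le k).trans_lt hk
  have hk' : (k : ℝ) ≤ ℓ := by exact_mod_cast hk.le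
  have hpi := Real.pi_pos
  have h : |Real.pi * k / ℓ| ≤ Real.pi := by
    rw [abs_of_nonneg (by positivity), div_le_iff₀ hℓ]
    exact mul_le_mul_of_nonneg_left hk' hpi.le
  have h2 := Real.cos_le_one_sub_mul_cos_sq h
  have h3 : 2 / Real.pi ^ 2 * (Real.pi * k / ℓ) ^ 2 = 2 * (k : ℝ) ^ 2 / ℓ ^ 2 := by
    field_simp
  have h4 : 4 * (k : ℝ) ^ 2 / ℓ ^ 2 = 2 * (2 * (k : ℝ) ^ 2 / ℓ ^ 2) := by ring
  unfold cosEig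
  linarith

lemma cosEig_le (ℓ k : ℕ) : cosEig ℓ k ≤ Real.pi ^ 2 * (k : ℝ) ^ 2 / ℓ ^ 2 := by
  have h := Real.one_sub_sq_div_two_le_cos (x := Real.pi * k / ℓ)
  have h4 : Real.pi ^ 2 * (k : ℝ) ^ 2 / ℓ ^ 2 = (Real.pi * k / ℓ) ^ 2 := by ring
  unfold cosEig
  linarith

lemma cosEig_nonneg (ℓ k : ℕ) : 0 ≤ cosEig ℓ k := by
  unfold cosEig
  linarith [Real.cos_le_one (Real.pi * k / ℓ)]

lemma cosEig_le_boxEig {d ℓ : ℕ} (k : Fin d → Fin ℓ) (i : Fin d) : cosEig ℓ (k i) ≤ boxEig k :=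
  Finset.single_le_sum (f := fun i => cosEig ℓ (k i)) (fun _ _ => cosEig_nonneg _ _)
    (Finset.mem_univ i)

lemma eq_zero_of_boxEig_eq_zero {d ℓ : ℕ} {k : Fin d → Fin ℓ} (h : boxEig k = 0) (i : Fin d) :
    (k i : ℕ) = 0 := by
  have hℓ : 0 < ℓ := (Nat.zero_le _).trans_lt (k i).2
  have h1 := (four_mul_sq_div_le_cosEig (k i).2).trans (h ▸ cosEig_le_boxEig k i)
  by_contra hne
  have : (0 : ℝ) < (k i : ℕ) := by exact_mod_cast Nat.pos_of_ne_zero hne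
  have : 0 < 4 * ((k i : ℕ) : ℝ) ^ 2 / ℓ ^ 2 := by positivity
  linarith

/-- The matrix whose rows are the normalized cosine modes. -/
def modeMatrix (d ℓ : ℕ) : Matrix (Fin d → Fin ℓ) (boxQ d ℓ) ℝ := fun k x =>
  boxMode k x / Real.sqrt (∑ y : boxQ d ℓ, boxMode k y ^ 2)

lemma modeMatrix_mul_transpose (d ℓ : ℕ) : modeMatrix d ℓ * (modeMatrix d ℓ).transpose = 1 := by
  ext k k'
  rw [Matrix.mul_apply]
  simp only [Matrix.transpose_apply, modeMatrix, div_mul_div_comm, ← Finset.sum_div]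
  by_cases h : k = k'
  · subst h
    have := boxMode_normSq_pos k
    rw [Matrix.one_apply_eq, Real.mul_self_sqrt this.le]
    simp only [← sq]
    exact div_self this.ne'
  · rw [Matrix.one_apply_ne h, boxMode_orthogonal h, zero_div]

lemma transpose_mul_modeMatrix (d ℓ : ℕ) : (modeMatrix d ℓ).transpose * modeMatrix d ℓ = 1 := by
  refine (Matrix.mul_eq_one_comm_of_card_eq _ _ _ ?_).mp (modeMatrix_mul_transpose d ℓ)
  rw [Fintype.card_coe, boxQ, Fintype.card_piFinset]
  simp

lemma sum_sq_modeMatrix_mulVec {d ℓ : ℕ} (v : boxQ d ℓ → ℝ) :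
    ∑ k, ((modeMatrix d ℓ).mulVec v k) ^ 2 = ∑ x, v x ^ 2 := by
  have h : (modeMatrix d ℓ).mulVec v ⬝ᵥ (modeMatrix d ℓ).mulVec v = v ⬝ᵥ v := by
    rw [Matrix.dotProduct_mulVec, ← Matrix.mulVec_transpose, Matrix.mulVec_mulVec,
      transpose_mul_modeMatrix, Matrix.one_mulVec]
  simpa only [dotProduct, ← sq] using h

lemma sum_sq_modeMatrix_row {d ℓ : ℕ} (k : Fin d → Fin ℓ) : ∑ x, modeMatrix d ℓ k x ^ 2 = 1 := by
  have h := congrFun (congrFun (modeMatrix_mul_transpose d ℓ) k) k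
  rw [Matrix.mul_apply, Matrix.one_apply_eq] at h
  simpa only [Matrix.transpose_apply, ← sq] using h

lemma modeMatrix_mulVec_boxLap {d ℓ : ℕ} (v : boxQ d ℓ → ℝ) (k : Fin d → Fin ℓ) :
    (modeMatrix d ℓ).mulVec ((boxLap d ℓ).mulVec v) k
      = boxEig k * (modeMatrix d ℓ).mulVec v k := by
  have h : (boxLap d ℓ).mulVec (modeMatrix d ℓ k) = boxEig k • modeMatrix d ℓ k := by
    have h1 : modeMatrix d ℓ k = (Real.sqrt (∑ y : boxQ d ℓ, boxMode k y ^ 2))⁻¹ •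
        fun y : boxQ d ℓ => boxMode k y := by
      ext x; simp [modeMatrix, div_eq_inv_mul]
    rw [h1, Matrix.mulVec_smul, smul_comm]
    congr 1
    ext x
    simpa using boxLap_mulVec_boxMode k x
  change modeMatrix d ℓ k ⬝ᵥ _ = boxEig k * (modeMatrix d ℓ k ⬝ᵥ v)
  rw [Matrix.dotProduct_mulVec, ← Matrix.mulVec_transpose, boxLap_isSymm, h, smul_dotProduct,
    smul_eq_mul]

lemma boxEig_mul_modeMatrix_mulVec_const {d ℓ : ℕ} (a : ℝ) (k : Fin d → Fin ℓ) :
    boxEig k * (modeMatrix d ℓ).mulVec (fun _ => a) k = 0 := by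
  rw [← modeMatrix_mulVec_boxLap]
  have : (boxLap d ℓ).mulVec (fun _ => a) = 0 := by
    ext x
    rw [boxLap_mulVec (fun _ => a)]
    simp
  simp [this]

lemma modeMatrix_mulVec_solution {d ℓ : ℕ} {g α : boxQ d ℓ → ℝ}
    (hg : (boxLap d ℓ).mulVec g = centered d ℓ α) (h0 : ∑ x, g x = 0) (k : Fin d → Fin ℓ) :
    (modeMatrix d ℓ).mulVec g k = (boxEig k)⁻¹ * (modeMatrix d ℓ).mulVec α k := by
  by_cases hk : boxEig k = 0
  · have h1 : ∀ x : boxQ d ℓ, boxMode k x = 1 := fun x => by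
      simp [boxMode, cosMode, eq_zero_of_boxEig_eq_zero hk]
    simp only [hk, inv_zero, zero_mul, Matrix.mulVec, dotProduct, modeMatrix, h1, ← Finset.mul_sum,
      h0, mul_zero]
  · have h := modeMatrix_mulVec_boxLap g k
    have hc : centered d ℓ α = α - fun _ => (∑ z, α z) / (ℓ : ℝ) ^ d := rfl
    have hz := (mul_eq_zero.mp
      (boxEig_mul_modeMatrix_mulVec_const ((∑ z, α z) / (ℓ : ℝ) ^ d) k)).resolve_left hk
    rw [hg, hc, Matrix.mulVec_sub, Pi.sub_apply, hz, sub_zero] at h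
    rw [h]
    field_simp

lemma memLp_dotProduct_gaussian {ι : Type*} [Fintype ι] (u : ι → ℝ) :
    MemLp (fun α : ι → ℝ => u ⬝ᵥ α) 2
      (Measure.pi fun _ => ProbabilityTheory.gaussianReal 0 1) := by
  refine memLp_finsetSum (f := fun i (α : ι → ℝ) => u i * α i) Finset.univ fun i _ => ?_
  exact ((ProbabilityTheory.memLp_id_gaussianReal 2).comp_measurePreserving
    (measurePreserving_eval (fun _ : ι => ProbabilityTheory.gaussianReal 0 1) i)).const_mul (u i)

lemma integral_sq_dotProduct_gaussian {ι : Type*} [Fintype ι] (u : ι → ℝ) :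
    ∫ α : ι → ℝ, (u ⬝ᵥ α) ^ 2 ∂(Measure.pi fun _ => ProbabilityTheory.gaussianReal 0 1)
      = ∑ i, u i ^ 2 := by
  have hmem : ∀ i, MemLp (fun t : ℝ => u i * t) 2 (ProbabilityTheory.gaussianReal 0 1) := fun i =>
    (ProbabilityTheory.memLp_id_gaussianReal 2).const_mul (u i)
  have h := ProbabilityTheory.variance_sum_pi hmem
  have hsum : (∑ i, fun α : ι → ℝ => u i * α i) = fun α => u ⬝ᵥ α := by
    ext α; simp [dotProduct]
  rw [hsum, ProbabilityTheory.variance_of_integral_eq_zero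
    (memLp_dotProduct_gaussian u).aestronglyMeasurable.aemeasurable] at h
  · rw [h]
    refine Finset.sum_congr rfl fun i _ => ?_
    rw [ProbabilityTheory.variance_const_mul]
    have : ProbabilityTheory.variance (fun t : ℝ => t) (ProbabilityTheory.gaussianReal 0 1) = 1 := by
      simp
    rw [this, mul_one]
  · simp only [dotProduct]
    rw [integral_finsetSum]
    · refine Finset.sum_eq_zero fun i _ => ?_
      rw [integral_const_mul, integral_eval]
      simp
    · intro i _
      have := ((hmem i).comp_measurePreserving
        (measurePreserving_eval (fun _ : ι => ProbabilityTheory.gaussianReal 0 1) i))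
      exact this.integrable one_le_two

lemma integral_sum_sq_solution {d ℓ : ℕ} {g : (boxQ d ℓ → ℝ) → (boxQ d ℓ → ℝ)}
    (hg : ∀ α, (boxLap d ℓ).mulVec (g α) = centered d ℓ α) (h0 : ∀ α, ∑ x, g α x = 0) :
    ∫ α, (∑ x, g α x ^ 2) ∂(disorderP d ℓ) = ∑ k : Fin d → Fin ℓ, ((boxEig k)⁻¹) ^ 2 := by
  simp only [← sum_sq_modeMatrix_mulVec (g _), modeMatrix_mulVec_solution (hg _) (h0 _), mul_pow]
  rw [integral_finsetSum]
  · refine Finset.sum_congr rfl fun k _ => ?_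
    rw [integral_const_mul]
    have := integral_sq_dotProduct_gaussian (modeMatrix d ℓ k)
    rw [sum_sq_modeMatrix_row] at this
    rw [disorderP]
    simp only [Matrix.mulVec]
    exact (congrArg _ this).trans (mul_one _)
  · intro k _
    exact (memLp_dotProduct_gaussian (modeMatrix d ℓ k)).integrable_sq.const_mul _

/-- The frequencies whose largest coordinate is `m`, attained at `i`. -/
def maxShell {d ℓ : ℕ} (i : Fin d) (m : Fin ℓ) : Finset (Fin d → Fin ℓ) :=
  Finset.univ.filter fun k => k i = m ∧ ∀ j, k j ≤ m

lemma card_maxShell {d ℓ : ℕ} (i : Fin d) (m : Fin ℓ) :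
    (maxShell i m).card = ((m : ℕ) + 1) ^ (d - 1) := by
  have h : maxShell i m
      = Fintype.piFinset fun j => if j = i then {m} else Finset.Iic m := by
    ext k
    simp only [maxShell, Finset.mem_filter, Finset.mem_univ, true_and, Fintype.mem_piFinset]
    constructor
    · rintro ⟨h1, h2⟩ j
      by_cases hj : j = i
      · subst hj; simpa using h1
      · simpa [hj] using h2 j
    · intro h
      have hi : k i = m := by simpa using h i
      refine ⟨hi, fun j => ?_⟩
      by_cases hj : j = i
      · subst hj; exact hi.le
      · simpa [hj] using h j
  rw [h, Fintype.card_piFinset, ← Finset.mul_prod_erase _ _ (Finset.mem_univ i), if_pos rfl,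
    Finset.card_singleton, one_mul, Finset.prod_congr rfl (g := fun _ => (m : ℕ) + 1)]
  · simp [Finset.card_erase_of_mem]
  · intro j hj
    rw [if_neg (Finset.ne_of_mem_erase hj), Fin.card_Iic]

/-- The sum to which the spectral sum is reduced by grouping frequencies by their maximum. -/
def shellSum (d ℓ : ℕ) : ℝ := ∑ m ∈ Finset.range ℓ, ((m : ℝ) + 1) ^ (d - 1) * ((m : ℝ) ^ 4)⁻¹

lemma sum_maxShell_const {d ℓ : ℕ} (i : Fin d) (a : ℝ) :
    ∑ m : Fin ℓ, ∑ _k ∈ maxShell i m, a * (((m : ℕ) : ℝ) ^ 4)⁻¹ = a * shellSum d ℓ := by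
  rw [shellSum, ← Fin.sum_univ_eq_sum_range
    (fun m : ℕ => ((m : ℝ) + 1) ^ (d - 1) * ((m : ℝ) ^ 4)⁻¹), Finset.mul_sum]
  refine Finset.sum_congr rfl fun m _ => ?_
  rw [Finset.sum_const, card_maxShell, nsmul_eq_mul]
  push_cast; ring

lemma inv_boxEig_sq_le {d ℓ : ℕ} {i : Fin d} {m : Fin ℓ} {k : Fin d → Fin ℓ}
    (hk : k ∈ maxShell i m) :
    ((boxEig k)⁻¹) ^ 2 ≤ (ℓ : ℝ) ^ 4 / 16 * (((m : ℕ) : ℝ) ^ 4)⁻¹ := by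
  simp only [maxShell, Finset.mem_filter, Finset.mem_univ, true_and] at hk
  obtain ⟨hi, hle⟩ := hk
  have hℓ : (0 : ℝ) < ℓ := by exact_mod_cast (Nat.zero_le _).trans_lt m.2
  by_cases hm : (m : ℕ) = 0
  · have h0 : ∀ j, (k j : ℕ) = 0 := fun j => by
      have : (k j : ℕ) ≤ m := hle j
      omega
    have : boxEig k = 0 := by simp [boxEig, cosEig, h0]
    rw [this, inv_zero, zero_pow two_ne_zero]
    positivity
  · have hm' : (0 : ℝ) < (m : ℕ) := by exact_mod_cast Nat.pos_of_ne_zero hm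
    have h := (four_mul_sq_div_le_cosEig (k i).2).trans (cosEig_le_boxEig k i)
    rw [hi] at h
    have hpos : 0 < boxEig k := lt_of_lt_of_le (by positivity) h
    calc ((boxEig k)⁻¹) ^ 2 ≤ ((4 * ((m : ℕ) : ℝ) ^ 2 / ℓ ^ 2)⁻¹) ^ 2 := by gcongr
      _ = _ := by field_simp; norm_num

lemma le_inv_boxEig_sq {d ℓ : ℕ} {i : Fin d} {m : Fin ℓ} {k : Fin d → Fin ℓ}
    (hk : k ∈ maxShell i m) :
    (ℓ : ℝ) ^ 4 / (Real.pi ^ 4 * d ^ 2) * (((m : ℕ) : ℝ) ^ 4)⁻¹ ≤ ((boxEig k)⁻¹) ^ 2 := by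
  simp only [maxShell, Finset.mem_filter, Finset.mem_univ, true_and] at hk
  obtain ⟨hi, hle⟩ := hk
  have hℓ : (0 : ℝ) < ℓ := by exact_mod_cast (Nat.zero_le _).trans_lt m.2
  have hd : (0 : ℝ) < d := by exact_mod_cast (Nat.zero_le _).trans_lt i.2
  by_cases hm : (m : ℕ) = 0
  · simp only [hm, Nat.cast_zero]
    norm_num
    positivity
  · have hm' : (0 : ℝ) < (m : ℕ) := by exact_mod_cast Nat.pos_of_ne_zero hm
    have h := (four_mul_sq_div_le_cosEig (k i).2).trans (cosEig_le_boxEig k i)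
    rw [hi] at h
    have hpos : 0 < boxEig k := lt_of_lt_of_le (by positivity) h
    have hup : boxEig k ≤ d * (Real.pi ^ 2 * ((m : ℕ) : ℝ) ^ 2 / ℓ ^ 2) := by
      have : boxEig k ≤ ∑ _j : Fin d, Real.pi ^ 2 * ((m : ℕ) : ℝ) ^ 2 / ℓ ^ 2 := by
        refine Finset.sum_le_sum fun j _ => (cosEig_le _ _).trans ?_
        have : ((k j : ℕ) : ℝ) ≤ (m : ℕ) := by exact_mod_cast hle j
        gcongr
      simpa using this
    calc (ℓ : ℝ) ^ 4 / (Real.pi ^ 4 * d ^ 2) * (((m : ℕ) : ℝ) ^ 4)⁻¹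
        = ((d * (Real.pi ^ 2 * ((m : ℕ) : ℝ) ^ 2 / ℓ ^ 2))⁻¹) ^ 2 := by field_simp
      _ ≤ _ := by gcongr

lemma sum_inv_boxEig_sq_le (d ℓ : ℕ) (hd : 0 < d) :
    ∑ k : Fin d → Fin ℓ, ((boxEig k)⁻¹) ^ 2 ≤ d / 16 * (ℓ : ℝ) ^ 4 * shellSum d ℓ := by
  have : Nonempty (Fin d) := ⟨⟨0, hd⟩⟩
  calc ∑ k : Fin d → Fin ℓ, ((boxEig k)⁻¹) ^ 2
      ≤ ∑ k : Fin d → Fin ℓ, ∑ p : Fin d × Fin ℓ,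
          if k ∈ maxShell p.1 p.2 then ((boxEig k)⁻¹) ^ 2 else 0 := by
        refine Finset.sum_le_sum fun k _ => ?_
        obtain ⟨i, hi⟩ := Finite.exists_max k
        have hmem : k ∈ maxShell i (k i) := by simpa [maxShell] using hi
        have := Finset.single_le_sum (f := fun p : Fin d × Fin ℓ =>
          if k ∈ maxShell p.1 p.2 then ((boxEig k)⁻¹) ^ 2 else 0)
          (fun p _ => by positivity) (Finset.mem_univ (i, k i))
        simpa [hmem] using this
    _ = ∑ i : Fin d, ∑ m : Fin ℓ, ∑ k ∈ maxShell i m, ((boxEig k)⁻¹) ^ 2 := by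
        rw [Finset.sum_comm, Fintype.sum_prod_type]
        simp
    _ ≤ ∑ i : Fin d, ∑ m : Fin ℓ, ∑ _k ∈ maxShell i m,
          (ℓ : ℝ) ^ 4 / 16 * (((m : ℕ) : ℝ) ^ 4)⁻¹ :=
        Finset.sum_le_sum fun i _ => Finset.sum_le_sum fun m _ => Finset.sum_le_sum fun k hk =>
          inv_boxEig_sq_le hk
    _ = d / 16 * (ℓ : ℝ) ^ 4 * shellSum d ℓ := by
        simp only [sum_maxShell_const]
        simp; ring

lemma le_sum_inv_boxEig_sq (d ℓ : ℕ) (hd : 0 < d) :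
    1 / (Real.pi ^ 4 * d ^ 2) * (ℓ : ℝ) ^ 4 * shellSum d ℓ
      ≤ ∑ k : Fin d → Fin ℓ, ((boxEig k)⁻¹) ^ 2 := by
  let i : Fin d := ⟨0, hd⟩
  calc 1 / (Real.pi ^ 4 * d ^ 2) * (ℓ : ℝ) ^ 4 * shellSum d ℓ
      = ∑ m : Fin ℓ, ∑ _k ∈ maxShell i m,
          (ℓ : ℝ) ^ 4 / (Real.pi ^ 4 * d ^ 2) * (((m : ℕ) : ℝ) ^ 4)⁻¹ := by
        rw [sum_maxShell_const]; ring
    _ ≤ ∑ m : Fin ℓ, ∑ k ∈ maxShell i m, ((boxEig k)⁻¹) ^ 2 :=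
        Finset.sum_le_sum fun m _ => Finset.sum_le_sum fun k hk => le_inv_boxEig_sq hk
    _ ≤ ∑ m : Fin ℓ, ∑ k : Fin d → Fin ℓ with k i = m, ((boxEig k)⁻¹) ^ 2 := by
        refine Finset.sum_le_sum fun m _ => Finset.sum_le_sum_of_subset_of_nonneg ?_
          fun k _ _ => sq_nonneg _
        intro k hk
        simp only [maxShell, Finset.mem_filter, Finset.mem_univ, true_and] at hk ⊢
        exact hk.1
    _ = ∑ k : Fin d → Fin ℓ, ((boxEig k)⁻¹) ^ 2 :=
        Finset.sum_fiberwise Finset.univ (fun k : Fin d → Fin ℓ => k i) _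

lemma sum_range_inv_sq_le_two (n : ℕ) : ∑ m ∈ Finset.range n, ((m : ℝ) ^ 2)⁻¹ ≤ 2 := by
  have key : ∀ n : ℕ, ∑ m ∈ Finset.range (n + 2), ((m : ℝ) ^ 2)⁻¹ ≤ 2 - 1 / ((n : ℝ) + 1) := by
    intro n
    induction n with
    | zero => norm_num [Finset.sum_range_succ]
    | succ n ih =>
      rw [Finset.sum_range_succ]
      have : ((((n + 2 : ℕ) : ℝ)) ^ 2)⁻¹ ≤ 1 / ((n : ℝ) + 1) - 1 / ((n : ℝ) + 2) := by
        push_cast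
        rw [div_sub_div _ _ (by positivity) (by positivity), inv_eq_one_div,
          div_le_div_iff₀ (by positivity) (by positivity)]
        nlinarith
      have h2 : (((n + 1 : ℕ) : ℝ)) + 1 = n + 2 := by push_cast; ring
      rw [h2]
      linarith
  calc ∑ m ∈ Finset.range n, ((m : ℝ) ^ 2)⁻¹
      ≤ ∑ m ∈ Finset.range (n + 2), ((m : ℝ) ^ 2)⁻¹ :=
        Finset.sum_le_sum_of_subset_of_nonneg (Finset.range_mono (by omega))
          fun _ _ _ => by positivity
    _ ≤ 2 - 1 / ((n : ℝ) + 1) := key n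
    _ ≤ 2 := by
      have : 0 ≤ 1 / ((n : ℝ) + 1) := by positivity
      linarith

lemma one_le_shellSum (d : ℕ) {ℓ : ℕ} (hℓ : 2 ≤ ℓ) : 1 ≤ shellSum d ℓ := by
  have h := Finset.single_le_sum
    (f := fun m : ℕ => ((m : ℝ) + 1) ^ (d - 1) * ((m : ℝ) ^ 4)⁻¹)
    (fun m _ => by positivity) (Finset.mem_range.mpr (show 1 < ℓ by omega))
  refine le_trans ?_ h
  norm_num
  exact one_le_pow₀ (by norm_num)

lemma shellSum_le {d : ℕ} (hd : d ≤ 3) (ℓ : ℕ) : shellSum d ℓ ≤ 8 := by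
  have : shellSum d ℓ ≤ ∑ m ∈ Finset.range ℓ, 4 * ((m : ℝ) ^ 2)⁻¹ := by
    refine Finset.sum_le_sum fun m _ => ?_
    rcases Nat.eq_zero_or_pos m with rfl | hm
    · simp
    · have h1 : (1 : ℝ) ≤ m := by exact_mod_cast hm
      have h2 : ((m : ℝ) + 1) ^ (d - 1) ≤ 4 * (m : ℝ) ^ 2 :=
        calc ((m : ℝ) + 1) ^ (d - 1) ≤ ((m : ℝ) + 1) ^ 2 :=
              pow_le_pow_right₀ (by linarith) (by omega)
          _ ≤ (2 * (m : ℝ)) ^ 2 := by gcongr; linarith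
          _ = 4 * (m : ℝ) ^ 2 := by ring
      calc ((m : ℝ) + 1) ^ (d - 1) * ((m : ℝ) ^ 4)⁻¹ ≤ 4 * (m : ℝ) ^ 2 * ((m : ℝ) ^ 4)⁻¹ := by
            gcongr
        _ = 4 * ((m : ℝ) ^ 2)⁻¹ := by field_simp
  rw [← Finset.mul_sum] at this
  linarith [sum_range_inv_sq_le_two ℓ]

lemma sum_range_inv_eq_harmonic (n : ℕ) :
    ∑ m ∈ Finset.range (n + 1), (m : ℝ)⁻¹ = (harmonic n : ℝ) := by
  rw [Finset.sum_range_succ', harmonic]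
  push_cast
  simp

lemma log_le_shellSum_four {ℓ : ℕ} (hℓ : 2 ≤ ℓ) : Real.log ℓ ≤ shellSum 4 ℓ := by
  obtain ⟨n, rfl⟩ : ∃ n, ℓ = n + 1 := ⟨ℓ - 1, by omega⟩
  refine (log_add_one_le_harmonic n).trans ?_
  rw [← sum_range_inv_eq_harmonic]
  refine Finset.sum_le_sum fun m _ => ?_
  rcases Nat.eq_zero_or_pos m with rfl | hm
  · simp
  · have h1 : (0 : ℝ) < m := by exact_mod_cast hm
    calc (m : ℝ)⁻¹ = (m : ℝ) ^ (4 - 1) * ((m : ℝ) ^ 4)⁻¹ := by norm_num; field_simp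
      _ ≤ _ := by gcongr; linarith

lemma shellSum_four_le_log {ℓ : ℕ} (hℓ : 2 ≤ ℓ) : shellSum 4 ℓ ≤ 24 * Real.log ℓ := by
  have hlog : Real.log 2 ≤ Real.log ℓ := Real.log_le_log (by norm_num) (by exact_mod_cast hℓ)
  have h2 := Real.log_two_gt_d9
  have h : shellSum 4 ℓ ≤ ∑ m ∈ Finset.range ℓ, 8 * (m : ℝ)⁻¹ := by
    refine Finset.sum_le_sum fun m _ => ?_
    rcases Nat.eq_zero_or_pos m with rfl | hm
    · simp
    · have h1 : (1 : ℝ) ≤ m := by exact_mod_cast hm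
      calc ((m : ℝ) + 1) ^ (4 - 1) * ((m : ℝ) ^ 4)⁻¹
          ≤ (2 * (m : ℝ)) ^ (4 - 1) * ((m : ℝ) ^ 4)⁻¹ := by gcongr; linarith
        _ = 8 * (m : ℝ)⁻¹ := by norm_num; field_simp; norm_num
  obtain ⟨n, rfl⟩ : ∃ n, ℓ = n + 1 := ⟨ℓ - 1, by omega⟩
  rw [← Finset.mul_sum, sum_range_inv_eq_harmonic] at h
  have h3 := harmonic_le_one_add_log n
  have h4 : Real.log n ≤ Real.log (n + 1 : ℕ) :=
    Real.log_le_log (by exact_mod_cast (show 0 < n by omega)) (by push_cast; linarith)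
  linarith

/-- Let `g(α)` be the unique mean-zero solution of `L g(α) = α̂` on the box
`Q_ℓ = {1,…,ℓ}^d`.  Then there are constants `0 < c ≤ C` such that for all `ℓ ≥ 2` the
per-site variance of the field `g` satisfies: if `d = 2`,
`c ℓ² ≤ ℓ^{-2} E[Σ_x g_x²] ≤ C ℓ²`; if `d = 3`, `c ℓ ≤ ℓ^{-3} E[Σ_x g_x²] ≤ C ℓ`; and if
`d = 4`, `c log ℓ ≤ ℓ^{-4} E[Σ_x g_x²] ≤ C log ℓ`. -/
theorem field_per_site_variance_order (d : ℕ) (hd : 2 ≤ d) :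
    ∃ c C : ℝ, 0 < c ∧ c ≤ C ∧
      ∀ ℓ : ℕ, 2 ≤ ℓ →
        ∀ g : (boxQ d ℓ → ℝ) → (boxQ d ℓ → ℝ),
          (∀ α, Matrix.mulVec (boxLap d ℓ) (g α) = centered d ℓ α) →
          (∀ α, ∑ x, g α x = 0) →
          (d = 2 →
            c * (ℓ : ℝ) ^ 2 ≤ (∫ α, (∑ x, g α x ^ 2) ∂(disorderP d ℓ)) / (ℓ : ℝ) ^ 2 ∧
            (∫ α, (∑ x, g α x ^ 2) ∂(disorderP d ℓ)) / (ℓ : ℝ) ^ 2 ≤ C * (ℓ : ℝ) ^ 2) ∧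
          (d = 3 →
            c * (ℓ : ℝ) ≤ (∫ α, (∑ x, g α x ^ 2) ∂(disorderP d ℓ)) / (ℓ : ℝ) ^ 3 ∧
            (∫ α, (∑ x, g α x ^ 2) ∂(disorderP d ℓ)) / (ℓ : ℝ) ^ 3 ≤ C * (ℓ : ℝ)) ∧
          (d = 4 →
            c * Real.log ℓ ≤ (∫ α, (∑ x, g α x ^ 2) ∂(disorderP d ℓ)) / (ℓ : ℝ) ^ 4 ∧
            (∫ α, (∑ x, g α x ^ 2) ∂(disorderP d ℓ)) / (ℓ : ℝ) ^ 4 ≤ C * Real.log ℓ) := by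
  have hd0 : 0 < d := by omega
  have hdR : (2 : ℝ) ≤ d := by exact_mod_cast hd
  have hpi4 : 1 ≤ Real.pi ^ 4 := one_le_pow₀ (by linarith [Real.pi_gt_three])
  have hden : 1 ≤ Real.pi ^ 4 * (d : ℝ) ^ 2 := one_le_mul_of_one_le_of_one_le hpi4
    (one_le_pow₀ (by linarith))
  refine ⟨1 / (Real.pi ^ 4 * d ^ 2), d / 16 * 24, by positivity, ?_, ?_⟩
  · calc 1 / (Real.pi ^ 4 * (d : ℝ) ^ 2) ≤ 1 := (div_le_one (by linarith)).mpr hden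
      _ ≤ d / 16 * 24 := by linarith
  intro ℓ hℓ g hg h0
  have hℓ0 : (0 : ℝ) < ℓ := by exact_mod_cast (show 0 < ℓ by omega)
  rw [integral_sum_sq_solution hg h0]
  have hlow := le_sum_inv_boxEig_sq d ℓ hd0
  have hupp := sum_inv_boxEig_sq_le d ℓ hd0
  have main : ∀ a : ℝ, a ≤ shellSum d ℓ → shellSum d ℓ ≤ 24 * a →
      1 / (Real.pi ^ 4 * d ^ 2) * (ℓ : ℝ) ^ 4 * a ≤ ∑ k : Fin d → Fin ℓ, ((boxEig k)⁻¹) ^ 2 ∧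
      ∑ k : Fin d → Fin ℓ, ((boxEig k)⁻¹) ^ 2 ≤ d / 16 * 24 * (ℓ : ℝ) ^ 4 * a := by
    intro a h1 h2
    refine ⟨le_trans (by gcongr) hlow, hupp.trans ?_⟩
    calc d / 16 * (ℓ : ℝ) ^ 4 * shellSum d ℓ ≤ d / 16 * (ℓ : ℝ) ^ 4 * (24 * a) := by gcongr
      _ = _ := by ring
  have hsmall : d ≤ 3 → _ := fun h3 => main 1 (one_le_shellSum d hℓ)
    ((shellSum_le h3 ℓ).trans (by norm_num))
  refine ⟨fun h => ?_, fun h => ?_, fun h => ?_⟩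
  · obtain ⟨h1, h2⟩ := hsmall (by omega)
    rw [le_div_iff₀ (by positivity), div_le_iff₀ (by positivity)]
    exact ⟨by linarith, by linarith⟩
  · obtain ⟨h1, h2⟩ := hsmall (by omega)
    rw [le_div_iff₀ (by positivity), div_le_iff₀ (by positivity)]
    exact ⟨by linarith, by linarith⟩
  · obtain ⟨h1, h2⟩ := main (Real.log ℓ) (by subst h; exact log_le_shellSum_four hℓ)
      (by subst h; exact shellSum_four_le_log hℓ)
    rw [le_div_iff₀ (by positivity), div_le_iff₀ (by positivity)]
    exact ⟨by linarith, by linarith⟩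

end
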